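/- arXiv:1703.10526 — 3 statements merged into one kernel-verified Lean document; each statement's English description precedes it below -/
import Mathlib

section
/- Let p be an odd prime and let j, d, ℓ, m be natural numbers with 1 ≤ m ≤ p^{j+1} − 2p^j. Set n = m + ℓ·p^{j+1}. Then (if d ≤ j then 2·p^{j−d} else 0) + ⌈n/p^d⌉ = ⌈(n + 2p^j)/p^d⌉. (This is the arithmetic identity dim(V_j^{C_{p^d}}) + ⌈(m+ℓp^{j+1})/p^d⌉ = ⌈(m+ℓp^{j+1}+2p^j)/p^d⌉ proved in Theorem 4.4, which yields the slice equivalences Σ^{V_j}: τ_{≥n} ≅ τ_{≥n+2p^j} for cyclic p-groups.) -/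
/-- The rational ceiling of `a / b` equals `q + 1` when `q * b < a ≤ (q + 1) * b`. -/
theorem ceil_natCast_div_eq {a b q : ℕ} (h₁ : q * b < a) (h₂ : a ≤ (q + 1) * b) :
    ⌈(a : ℚ) / (b : ℚ)⌉ = (q : ℤ) + 1 := by
  have hb : 0 < b := by
    rcases Nat.eq_zero_or_pos b with rfl | hb
    · omega
    · exact hb
  have hb' : (0 : ℚ) < b := by exact_mod_cast hb
  rw [Int.ceil_eq_iff, lt_div_iff₀ hb', div_le_iff₀ hb']
  push_cast
  rw [add_sub_cancel_right]
  exact ⟨by exact_mod_cast h₁, by exact_mod_cast h₂⟩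

/-- The arithmetic identity `dim(V_j^{C_{p^d}}) + ⌈(m+ℓp^{j+1})/p^d⌉ = ⌈(m+ℓp^{j+1}+2p^j)/p^d⌉`
from the proof of Theorem 4.4, where `dim(V_j^{C_{p^d}}) = 2p^{j-d}` for `d ≤ j` and `0`
otherwise. -/
theorem slice_equivalence_arith (p j d ℓ m : ℕ) (hp : p.Prime) (hodd : Odd p)
    (hm1 : 1 ≤ m) (hm2 : m ≤ p ^ (j + 1) - 2 * p ^ j) :
    ((if d ≤ j then 2 * p ^ (j - d) else 0 : ℕ) : ℤ)
      + ⌈((m + ℓ * p ^ (j + 1) : ℕ) : ℚ) / (p ^ d : ℚ)⌉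
      = ⌈((m + ℓ * p ^ (j + 1) + 2 * p ^ j : ℕ) : ℚ) / (p ^ d : ℚ)⌉ := by
  have hp0 : (p : ℚ) ≠ 0 := by exact_mod_cast hp.ne_zero
  split_ifs with hd
  · obtain ⟨e, rfl⟩ := Nat.exists_eq_add_of_le hd
    have key : ((m + ℓ * p ^ (d + e + 1) + 2 * p ^ (d + e) : ℕ) : ℚ) / (p ^ d : ℚ)
        = ((m + ℓ * p ^ (d + e + 1) : ℕ) : ℚ) / (p ^ d : ℚ) + ((2 * p ^ e : ℕ) : ℤ) := by
      push_cast
      field_simp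
      ring
    rw [key, Int.ceil_add_intCast, Nat.add_sub_cancel_left, add_comm]
  · obtain ⟨e, rfl⟩ : ∃ e, d = e + (j + 1) := ⟨d - (j + 1), by omega⟩
    have hpe : 0 < p ^ e := pow_pos hp.pos e
    have hle : m + 2 * p ^ j ≤ p ^ (j + 1) := by omega
    have hlow : ℓ / p ^ e * p ^ (e + (j + 1)) ≤ ℓ * p ^ (j + 1) := by
      rw [pow_add p e, ← mul_assoc]
      exact Nat.mul_le_mul_right _ (Nat.div_mul_le_self ℓ (p ^ e))
    have hupp : (ℓ + 1) * p ^ (j + 1) ≤ (ℓ / p ^ e + 1) * p ^ (e + (j + 1)) := by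
      rw [pow_add p e, ← mul_assoc]
      exact Nat.mul_le_mul_right _ (Nat.lt_mul_of_div_lt (Nat.lt_succ_self _) hpe)
    rw [add_mul, one_mul] at hupp
    rw [← Nat.cast_pow, ceil_natCast_div_eq (q := ℓ / p ^ e) (by omega) (by omega),
      ceil_natCast_div_eq (q := ℓ / p ^ e) (by omega) (by omega), Nat.cast_zero, zero_add]
end

section
/- Let p be a prime, k ≥ 1, and let ζ ∈ ℂ be a primitive p^k-th root of unity. Fix j with 0 ≤ j ≤ k − 1, and set c_0 = 1 and c_i = p^i − p^{i−1} for 1 ≤ i ≤ j. Consider the complex representation of the cyclic group ℤ/p^k on V = ∏_{i=0}^{j} ℂ^{c_i} in which the element g ∈ ℤ/p^k acts on the i-th factor by scalar multiplication by ζ^{p^{j−i}·g}. Then for every d with 0 ≤ d ≤ k, the subspace of vectors fixed by every element g of the subgroup {g ∈ ℤ/p^k : p^{k−d} ∣ g} (the subgroup of order p^d) has complex dimension p^{j−d} if d ≤ j, and 0 if d > j. (This is the computation dim(V_j^{C_{p^d}}) = 2p^{j−d} for d ≤ j and 0 for d > j — in real dimensions — used in the proof of Theorem 4.4, where V_j =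 ⊕_{i=0}^{j}(p^i − ⌊p^{i−1}⌋)·λ_{j−i} and λ_{j−i} is the 2-dimensional real rotation representation, i.e., the complex line on which a generator acts by ζ^{p^{j−i}}.) -/
/-- A product of submodules is linearly equivalent to the dependent product of the submodules. -/
def Submodule.piUnivEquiv {R ι : Type*} [Semiring R] {M : ι → Type*}
    [∀ i, AddCommMonoid (M i)] [∀ i, Module R (M i)] (q : ∀ i, Submodule R (M i)) :
    Submodule.pi Set.univ q ≃ₗ[R] ∀ i, q i where
  toFun v i := ⟨v.1 i, v.2 i trivial⟩
  invFun w := ⟨fun i => w i, fun i _ => (w i).2⟩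
  map_add' _ _ := rfl
  map_smul' _ _ := rfl
  left_inv _ := rfl
  right_inv _ := rfl

/-- The scalar by which a generator of the subgroup of order `p ^ d` acts is trivial exactly when
`d + i ≤ j`. -/
theorem IsPrimitiveRoot.forall_pow_prime_pow_mul_val_eq_one_iff {p k d i j : ℕ} (hp : p.Prime)
    {ζ : ℂ} (hζ : IsPrimitiveRoot ζ (p ^ k)) (hd : d ≤ k) (hi : i ≤ j) :
    (∀ g : ZMod (p ^ k), p ^ (k - d) ∣ g.val → ζ ^ (p ^ (j - i) * g.val) = 1) ↔ d + i ≤ j := by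
  constructor
  · intro h
    rcases Nat.eq_zero_or_pos d with rfl | hd0
    · simpa using hi
    have hlt : p ^ (k - d) < p ^ k := Nat.pow_lt_pow_right hp.one_lt (by omega)
    have hval : ((p ^ (k - d) : ℕ) : ZMod (p ^ k)).val = p ^ (k - d) :=
      ZMod.val_cast_of_lt hlt
    have h1 := h ((p ^ (k - d) : ℕ) : ZMod (p ^ k)) (by rw [hval])
    rw [hval, ← pow_add, hζ.pow_eq_one_iff_dvd, Nat.pow_dvd_pow_iff_le_right hp.one_lt] at h1
    omega
  · intro h g hg
    rw [hζ.pow_eq_one_iff_dvd]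
    calc p ^ k ∣ p ^ (j - i) * p ^ (k - d) := by
          rw [← pow_add]
          exact pow_dvd_pow p (by omega)
      _ ∣ p ^ (j - i) * g.val := mul_dvd_mul_left _ hg

/-- The multiplicities `c 0 = 1`, `c i = p ^ i - p ^ (i - 1)` telescope to `p ^ n`. -/
theorem Nat.sum_range_succ_pow_sub_pow_pred {p n : ℕ} (hp : 0 < p) {c : ℕ → ℕ} (hc0 : c 0 = 1)
    (hc : ∀ i, 1 ≤ i → i ≤ n → c i = p ^ i - p ^ (i - 1)) :
    ∑ i ∈ Finset.range (n + 1), c i = p ^ n := by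
  induction n with
  | zero => simp [hc0]
  | succ n ih =>
    rw [Finset.sum_range_succ, ih fun i h1 h2 => hc i h1 (by omega),
      hc (n + 1) (by omega) le_rfl, Nat.add_sub_cancel]
    exact Nat.add_sub_cancel' (Nat.pow_le_pow_right hp n.le_succ)


/-- The computation `dim_ℂ(V_j^{C_{p^d}}) = p^{j-d}` for `d ≤ j` and `0` for `d > j`
(Theorem 4.4), for the complex form of the `C_{p^k}`-representation
`V_j = ⊕_{i=0}^{j} (p^i - ⌊p^{i-1}⌋)·λ_{j-i}`.  The representation is given on
`V = ∏_{i=0}^{j} ℂ^{c_i}` (with `c_0 = 1` and `c_i = p^i - p^{i-1}`) by letting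
`g ∈ ℤ/p^k` act on the `i`-th factor as the scalar `ζ^{p^{j-i}·g}`, and the fixed
subspace of the subgroup `{g : p^{k-d} ∣ g}` of order `p^d` is the intersection of
the kernels of `act g - id`. -/
theorem fixed_dim_Vj (p k : ℕ) (hp : p.Prime) (hk : 1 ≤ k) (ζ : ℂ)
    (hζ : IsPrimitiveRoot ζ (p ^ k)) (j : ℕ) (hj : j ≤ k - 1)
    (c : ℕ → ℕ) (hc0 : c 0 = 1) (hc : ∀ i, 1 ≤ i → i ≤ j → c i = p ^ i - p ^ (i - 1))
    (act : ZMod (p ^ k) →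
      ((∀ i : Fin (j + 1), Fin (c i) → ℂ) →ₗ[ℂ] (∀ i : Fin (j + 1), Fin (c i) → ℂ)))
    (hact : ∀ (g : ZMod (p ^ k)) (v : ∀ i : Fin (j + 1), Fin (c i) → ℂ)
      (i : Fin (j + 1)), act g v i = ζ ^ (p ^ (j - (i : ℕ)) * g.val) • v i)
    (d : ℕ) (hd : d ≤ k) :
    Module.finrank ℂ
      ↥(⨅ g ∈ {g : ZMod (p ^ k) | (p ^ (k - d) : ℕ) ∣ g.val},
          LinearMap.ker (act g - LinearMap.id)) =
      if d ≤ j then p ^ (j - d) else 0 := by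
  have hfix : (⨅ g ∈ {g : ZMod (p ^ k) | (p ^ (k - d) : ℕ) ∣ g.val},
      LinearMap.ker (act g - LinearMap.id)) =
      Submodule.pi Set.univ fun i : Fin (j + 1) =>
        if d + (i : ℕ) ≤ j then (⊤ : Submodule ℂ (Fin (c i) → ℂ)) else ⊥ := by
    ext v
    simp only [Submodule.mem_iInf, Set.mem_ofPred_eq, LinearMap.mem_ker, LinearMap.sub_apply,
      LinearMap.id_apply, sub_eq_zero, Submodule.mem_pi, Set.mem_univ, true_imp_iff]
    have key (i : Fin (j + 1)) := hζ.forall_pow_prime_pow_mul_val_eq_one_iff hp hd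
      (show (i : ℕ) ≤ j by omega)
    constructor
    · intro h i
      split_ifs with hi
      · trivial
      · rw [Submodule.mem_bot]
        by_contra hv
        refine hi ((key i).1 fun g hg => ?_)
        have hgi := congrFun (h g hg) i
        rw [hact] at hgi
        exact smul_left_injective ℂ hv (hgi.trans (one_smul ℂ _).symm)
    · intro h g hg
      funext i
      rw [hact]
      have hvi := h i
      split_ifs at hvi with hi
      · rw [(key i).2 hi g hg, one_smul]
      · rw [(Submodule.mem_bot ℂ).1 hvi, smul_zero]
  have hdim (i : Fin (j + 1)) : Module.finrank ℂ
      ↥(if d + (i : ℕ) ≤ j then (⊤ : Submodule ℂ (Fin (c i) → ℂ)) else ⊥) =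
      if d + (i : ℕ) ≤ j then c i else 0 := by
    split_ifs with hi
    · rw [if_pos hi]
      simp
    · rw [if_neg hi]
      simp
  rw [hfix, (Submodule.piUnivEquiv _).finrank_eq, Module.finrank_pi_fintype,
    Finset.sum_congr rfl fun i _ => hdim i,
    Fin.sum_univ_eq_sum_range (fun i => if d + i ≤ j then c i else 0) (j + 1),
    ← Finset.sum_filter]
  split_ifs with hdj
  · rw [← Nat.sum_range_succ_pow_sub_pow_pred (n := j - d) hp.pos hc0
      fun i h1 h2 => hc i h1 (by omega)]
    congr 1
    ext i
    simp only [Finset.mem_filter, Finset.mem_range]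
    omega
  · refine Finset.sum_eq_zero fun i hi => ?_
    have := (Finset.mem_filter.1 hi).2
    omega
end

section
/- Let p be an odd prime and k ≥ 1 a natural number. Define a relation R on the integers by: R(a, b) holds if and only if either b = a + p^k, or a ≥ 0 and there exists j with 0 ≤ j ≤ k − 1 such that 1 ≤ (a mod p^{j+1}) ≤ p^{j+1} − 2p^j and b = a + 2p^j. Then every integer z is related, under the equivalence relation generated by R, to exactly one integer of the form Σ_{i=0}^{k−1} a_i p^i with a_0 ∈ {1, 2} and a_i ∈ {0, 1} for 1 ≤ i ≤ k − 1; in particular, the equivalence relation generated by R has exactly 2^k equivalence classes. (This is the combinatorial content of the Corollary to Theorem 4.4: the equivalences Σ^{V_j}: τ_{≥n} ≅ τ_{≥n+2p^j} for n ≡ m (mod p^{j+1}) with 1 ≤ m ≤ p^{j+1} − 2p^j, together with Σ^{ρ_{p^k}}: τ_{≥n} ≅ τ_{≥n+p^k}, sort the slice categories τ_{≥n} into 2^k equivalence classes indexed by the listed representatives.) -/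
/-- The relation on indices of slice categories given by `n ↦ n + p ^ k` and
`n ↦ n + 2 * p ^ j`. -/
def SliceRel (p : ℤ) (k : ℕ) (a b : ℤ) : Prop :=
  b = a + p ^ k ∨
    (0 ≤ a ∧ ∃ j : ℕ, j ≤ k - 1 ∧ 1 ≤ a % p ^ (j + 1) ∧
      a % p ^ (j + 1) ≤ p ^ (j + 1) - 2 * p ^ j ∧ b = a + 2 * p ^ j)

/-- The `i`-th digit of the integer `y` in base `p`. -/
def baseDigit (p y : ℤ) (i : ℕ) : ℤ := y / p ^ i % p

section Digits

variable {p : ℤ}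

lemma baseDigit_add_pow (hp : 0 < p) {i k : ℕ} (hik : i < k) (y m : ℤ) :
    baseDigit p (y + p ^ k * m) i = baseDigit p y i := by
  obtain ⟨t, rfl⟩ := Nat.exists_eq_add_of_lt hik
  have h : y + p ^ (i + t + 1) * m = y + p ^ i * (p * (p ^ t * m)) := by ring
  rw [baseDigit, baseDigit, h, Int.add_mul_ediv_left _ _ (pow_pos hp i).ne',
    Int.add_mul_emod_self_left]

lemma baseDigit_add_two_mul_pow_self (hp : 0 < p) {j : ℕ} {y : ℤ}
    (h : baseDigit p y j + 2 < p) :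
    baseDigit p (y + 2 * p ^ j) j = baseDigit p y j + 2 := by
  unfold baseDigit at *
  have h0 := Int.emod_nonneg (y / p ^ j) hp.ne'
  rw [Int.add_mul_ediv_right _ _ (pow_pos hp j).ne', ← Int.emod_add_emod,
    Int.emod_eq_of_lt (by omega) h]

lemma baseDigit_add_two_mul_pow_of_ne (hp : 0 < p) {i j : ℕ} (hij : i ≠ j) {y : ℤ}
    (h : baseDigit p y j + 2 < p) :
    baseDigit p (y + 2 * p ^ j) i = baseDigit p y i := by
  rcases hij.lt_or_gt with hij | hij
  · rw [mul_comm, baseDigit_add_pow hp hij]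
  · obtain ⟨t, rfl⟩ := Nat.exists_eq_add_of_lt hij
    unfold baseDigit at *
    have hdiv : (y / p ^ j + 2) / p = y / p ^ j / p := by
      have h0 := Int.emod_nonneg (y / p ^ j) hp.ne'
      have h1 := Int.emod_add_mul_ediv (y / p ^ j) p
      have h2 : y / p ^ j + 2 = (y / p ^ j % p + 2) + p * (y / p ^ j / p) := by linarith
      rw [h2, Int.add_mul_ediv_left _ _ hp.ne', Int.ediv_eq_zero_of_lt (by omega) h, zero_add]
    have hsplit (x : ℤ) : x / p ^ (j + t + 1) = x / p ^ j / p / p ^ t := by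
      rw [Int.ediv_ediv_of_nonneg (by positivity), Int.ediv_ediv_of_nonneg (by positivity)]
      ring_nf
    rw [hsplit, hsplit, Int.add_mul_ediv_right _ _ (pow_pos hp j).ne', hdiv]

lemma one_le_emod_and_emod_le_iff (hp : 0 < p) (a : ℤ) (j : ℕ) :
    (1 ≤ a % p ^ (j + 1) ∧ a % p ^ (j + 1) ≤ p ^ (j + 1) - 2 * p ^ j) ↔
      baseDigit p (a - 1) j + 2 < p := by
  have hpj : 0 < p ^ j := pow_pos hp j
  unfold baseDigit
  constructor
  · rintro ⟨h1, h2⟩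
    have h3 := Int.emod_add_mul_ediv a (p ^ (j + 1))
    set m := a % p ^ (j + 1)
    set q := a / p ^ (j + 1)
    have h4 : a - 1 = (m - 1) + p ^ j * (p * q) := by rw [← h3]; ring
    have h5 : (m - 1) / p ^ j < p - 2 := Int.ediv_lt_of_lt_mul hpj (by rw [pow_succ] at h2; linarith)
    have h6 : 0 ≤ (m - 1) / p ^ j := Int.ediv_nonneg (by omega) hpj.le
    rw [h4, Int.add_mul_ediv_left _ _ hpj.ne', Int.add_mul_emod_self_left,
      Int.emod_eq_of_lt h6 (by omega)]
    omega
  · intro h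
    have h1 := Int.emod_add_mul_ediv (a - 1) (p ^ j)
    have h2 := Int.emod_nonneg (a - 1) hpj.ne'
    have h3 := Int.emod_lt_of_pos (a - 1) hpj
    have h4 := Int.emod_add_mul_ediv ((a - 1) / p ^ j) p
    have h5 := Int.emod_nonneg ((a - 1) / p ^ j) hp.ne'
    set r := (a - 1) % p ^ j
    set d := (a - 1) / p ^ j % p
    set q := (a - 1) / p ^ j / p
    rw [← h4] at h1
    have h6 : a = (r + 1 + p ^ j * d) + p ^ (j + 1) * q := by
      rw [pow_succ]; linarith
    have h7 : p ^ j * d ≤ p ^ j * (p - 3) := mul_le_mul_of_nonneg_left (by omega) hpj.le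
    have h8 : 0 ≤ p ^ j * d := by positivity
    have h9 : p ^ (j + 1) = p ^ j * p := pow_succ p j
    have h10 : a % p ^ (j + 1) = r + 1 + p ^ j * d := by
      rw [h6, Int.add_mul_emod_self_left, Int.emod_eq_of_lt (by omega) (by linarith)]
    rw [h10]
    constructor <;> linarith

lemma baseDigit_sum {k : ℕ} (b : ℕ → ℤ) (hb : ∀ i < k, 0 ≤ b i ∧ b i < p) {j : ℕ}
    (hj : j < k) : baseDigit p (∑ i ∈ Finset.range k, b i * p ^ i) j = b j := by
  induction k generalizing b j with
  | zero => omega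
  | succ k ih =>
    have hp : 0 < p := by have := hb 0 (by omega); omega
    have hsum : ∑ i ∈ Finset.range (k + 1), b i * p ^ i =
        b 0 + p * ∑ i ∈ Finset.range k, b (i + 1) * p ^ i := by
      rw [Finset.sum_range_succ', Finset.mul_sum, add_comm]
      simp only [pow_zero, mul_one, pow_succ]
      congr 1
      exact Finset.sum_congr rfl fun _ _ => by ring
    obtain ⟨h0, h1⟩ := hb 0 (by omega)
    cases j with
    | zero => simp [baseDigit, hsum, Int.emod_eq_of_lt h0 h1]
    | succ j =>
      rw [baseDigit, hsum, pow_succ', ← Int.ediv_ediv_of_nonneg hp.le,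
        Int.add_mul_ediv_left _ _ hp.ne', Int.ediv_eq_zero_of_lt h0 h1, zero_add]
      exact ih (fun i => b (i + 1)) (fun i hi => hb (i + 1) (by omega)) (by omega)

end Digits

section Slice

variable {p : ℤ} {k : ℕ}

/-- The representative of the class of `z`: each base `p` digit of `z - 1` is replaced by its
residue modulo `2`. -/
def sliceRep (p : ℤ) (k : ℕ) (z : ℤ) : ℤ :=
  1 + ∑ i ∈ Finset.range k, baseDigit p (z - 1) i % 2 * p ^ i

lemma SliceRel.baseDigit_emod_two (hp : 0 < p) {a b : ℤ} (h : SliceRel p k a b)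
    {i : ℕ} (hi : i < k) : baseDigit p (a - 1) i % 2 = baseDigit p (b - 1) i % 2 := by
  rcases h with rfl | ⟨-, j, -, h1, h2, rfl⟩
  · rw [show a + p ^ k - 1 = a - 1 + p ^ k * 1 by ring, baseDigit_add_pow hp hi]
  · have hd := (one_le_emod_and_emod_le_iff hp a j).1 ⟨h1, h2⟩
    rw [show a + 2 * p ^ j - 1 = a - 1 + 2 * p ^ j by ring]
    rcases eq_or_ne i j with rfl | hij
    · rw [baseDigit_add_two_mul_pow_self hp hd]
      omega
    · rw [baseDigit_add_two_mul_pow_of_ne hp hij hd]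

lemma sliceRep_eq_of_eqvGen (hp : 0 < p) {a b : ℤ}
    (h : Relation.EqvGen (SliceRel p k) a b) : sliceRep p k a = sliceRep p k b := by
  induction h with
  | rel a b h =>
    unfold sliceRep
    congr 1
    exact Finset.sum_congr rfl fun i hi => by
      rw [h.baseDigit_emod_two hp (Finset.mem_range.1 hi)]
  | refl => rfl
  | symm _ _ _ ih => exact ih.symm
  | trans _ _ _ _ _ ih₁ ih₂ => exact ih₁.trans ih₂

lemma eqvGen_add_pow_mul (a m : ℤ) :
    Relation.EqvGen (SliceRel p k) a (a + p ^ k * m) := by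
  induction m using Int.induction_on with
  | zero => simpa using Relation.EqvGen.refl a
  | succ i ih => exact ih.trans _ _ _ (.rel _ _ (.inl (by ring)))
  | pred i ih => exact ih.trans _ _ _ (.symm _ _ (.rel _ _ (.inl (by ring))))

lemma eqvGen_add_two_mul_pow (hp : 0 < p) {j : ℕ} (hj : j < k) {a : ℤ}
    (h : baseDigit p (a - 1) j + 2 < p) :
    Relation.EqvGen (SliceRel p k) a (a + 2 * p ^ j) := by
  have hpk : 0 < p ^ k := pow_pos hp k
  have hpos : 0 ≤ a + p ^ k * |a| := by nlinarith [neg_abs_le a, abs_nonneg a]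
  have hd : baseDigit p (a + p ^ k * |a| - 1) j + 2 < p := by
    rwa [add_sub_right_comm, baseDigit_add_pow hp hj]
  obtain ⟨h1, h2⟩ := (one_le_emod_and_emod_le_iff hp _ j).2 hd
  refine (eqvGen_add_pow_mul a |a|).trans _ _ _ (.trans _ _ _
    (.rel _ _ (.inr ⟨hpos, j, by omega, h1, h2, rfl⟩)) ?_)
  rw [add_right_comm]
  exact (eqvGen_add_pow_mul _ _).symm

lemma eqvGen_add_two_mul_mul_pow (hp : 0 < p) {j : ℕ} (hj : j < k) {a : ℤ} (t : ℕ)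
    (h : baseDigit p (a - 1) j + 2 * t < p) :
    Relation.EqvGen (SliceRel p k) a (a + 2 * t * p ^ j) ∧
      baseDigit p (a + 2 * t * p ^ j - 1) j = baseDigit p (a - 1) j + 2 * t := by
  induction t with
  | zero => simpa using Relation.EqvGen.refl a
  | succ t ih =>
    push_cast at h ⊢
    obtain ⟨ih₁, ih₂⟩ := ih (by omega)
    have hlt : baseDigit p (a + 2 * t * p ^ j - 1) j + 2 < p := by omega
    have heq : a + 2 * ((t : ℤ) + 1) * p ^ j = a + 2 * t * p ^ j + 2 * p ^ j := by ring
    refine ⟨ih₁.trans _ _ _ (heq ▸ eqvGen_add_two_mul_pow hp hj hlt), ?_⟩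
    rw [heq, add_sub_right_comm, baseDigit_add_two_mul_pow_self hp hlt, ih₂]
    ring

lemma sum_emod_two_mul_pow_mem (hp : 2 ≤ p) (b : ℕ → ℤ) (n : ℕ) :
    0 ≤ ∑ i ∈ Finset.range n, b i % 2 * p ^ i ∧
      ∑ i ∈ Finset.range n, b i % 2 * p ^ i < p ^ n := by
  induction n with
  | zero => simp
  | succ n ih =>
    have hpn : 0 < p ^ n := by positivity
    rw [Finset.sum_range_succ, pow_succ]
    rcases Int.emod_two_eq_zero_or_one (b n) with h | h <;> rw [h] <;> constructor <;> nlinarith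

lemma eqvGen_sliceRep (hp : 2 ≤ p) (z : ℤ) :
    Relation.EqvGen (SliceRel p k) z (sliceRep p k z) := by
  have hp0 : 0 < p := by omega
  have key (n : ℕ) (hn : n ≤ k) : Relation.EqvGen (SliceRel p k) z
      (1 + ∑ i ∈ Finset.range n, baseDigit p (z - 1) i % 2 * p ^ i + p ^ n * ((z - 1) / p ^ n)) := by
    induction n with
    | zero => simpa using Relation.EqvGen.refl z
    | succ n ih =>
      have hpn : 0 < p ^ n := pow_pos hp0 n
      refine (ih (by omega)).trans _ _ _ (.symm _ _ ?_)
      obtain ⟨hs0, hs1⟩ := sum_emod_two_mul_pow_mem hp (baseDigit p (z - 1)) n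
      rw [Finset.sum_range_succ]
      set s := ∑ i ∈ Finset.range n, baseDigit p (z - 1) i % 2 * p ^ i
      set d := baseDigit p (z - 1) n with hd
      have hd0 : 0 ≤ d := Int.emod_nonneg _ hp0.ne'
      have hd1 : d < p := Int.emod_lt_of_pos _ hp0
      have hdiv : (z - 1) / p ^ n = d + p * ((z - 1) / p ^ (n + 1)) := by
        rw [pow_succ, ← Int.ediv_ediv_of_nonneg hpn.le]
        exact (Int.emod_add_mul_ediv _ _).symm
      set q := (z - 1) / p ^ (n + 1)
      have hdig : baseDigit p (1 + (s + d % 2 * p ^ n) + p ^ (n + 1) * q - 1) n = d % 2 := by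
        rw [baseDigit, show 1 + (s + d % 2 * p ^ n) + p ^ (n + 1) * q - 1
            = s + p ^ n * (d % 2 + p * q) by ring, Int.add_mul_ediv_left _ _ hpn.ne',
          Int.ediv_eq_zero_of_lt hs0 hs1, zero_add, Int.add_mul_emod_self_left]
        exact Int.emod_eq_of_lt (by omega) (by omega)
      have ht : ((d / 2).toNat : ℤ) = d / 2 := Int.toNat_of_nonneg (by omega)
      have hmove := (eqvGen_add_two_mul_mul_pow (a := 1 + (s + d % 2 * p ^ n) + p ^ (n + 1) * q)
        hp0 (Nat.lt_of_succ_le hn) (d / 2).toNat (by rw [hdig, ht]; omega)).1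
      rw [ht] at hmove
      convert hmove using 1
      rw [hdiv]
      have h2 : d = d % 2 + 2 * (d / 2) := (Int.emod_add_mul_ediv d 2).symm
      linear_combination p ^ n * h2
  exact (key k le_rfl).trans _ _ _ (eqvGen_add_pow_mul _ _).symm

lemma sliceRep_one_add_sum (hp : 2 ≤ p) (b : ℕ → ℤ) (hb : ∀ i < k, b i = 0 ∨ b i = 1) :
    sliceRep p k (1 + ∑ i ∈ Finset.range k, b i * p ^ i) =
      1 + ∑ i ∈ Finset.range k, b i * p ^ i := by
  rw [sliceRep, add_sub_cancel_left]
  congr 1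
  refine Finset.sum_congr rfl fun i hi => ?_
  have hi := Finset.mem_range.1 hi
  rw [baseDigit_sum b (fun i hi => by have := hb i hi; omega) hi]
  rcases hb i hi with h | h <;> simp [h]

lemma card_quot_sliceRel (hp : 2 ≤ p) : Nat.card (Quot (SliceRel p k)) = 2 ^ k := by
  have hp0 : 0 < p := by omega
  let f : Quot (SliceRel p k) → Fin k → Bool :=
    Quot.lift (fun z i => decide (baseDigit p (z - 1) i % 2 = 1)) fun a b h => by
      funext i
      rw [h.baseDigit_emod_two hp0 i.2]
  have hf : Function.Bijective f := by
    constructor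
    · rintro ⟨a⟩ ⟨b⟩ h
      have hrep : sliceRep p k a = sliceRep p k b := by
        unfold sliceRep
        congr 1
        refine Finset.sum_congr rfl fun i hi => ?_
        have hi := decide_eq_decide.1 (congrFun h ⟨i, Finset.mem_range.1 hi⟩)
        dsimp only at hi
        congr 1
        omega
      refine Quot.eqvGen_sound ((eqvGen_sliceRep hp a).trans _ _ _ ?_)
      rw [hrep]
      exact (eqvGen_sliceRep hp b).symm
    · intro c
      let b : ℕ → ℤ := fun i => if h : i < k then (if c ⟨i, h⟩ then 1 else 0) else 0
      refine ⟨Quot.mk _ (1 + ∑ i ∈ Finset.range k, b i * p ^ i), funext fun i => ?_⟩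
      change decide (baseDigit p (_ - 1) i % 2 = 1) = c i
      rw [add_sub_cancel_left, baseDigit_sum b (fun i _ => by dsimp only [b]; split_ifs <;> omega) i.2]
      cases hc : c i <;> simp [b, hc]
  rw [Nat.card_congr (Equiv.ofBijective f hf)]
  simp

end Slice


/-- The combinatorial content of the Corollary to Theorem 4.4: the relation generated
by `n ↦ n + p^k` and `n ↦ n + 2p^j` (for `n ≥ 0` with `n mod p^{j+1} = m`,
`1 ≤ m ≤ p^{j+1} - 2p^j`, `0 ≤ j ≤ k-1`) relates every integer to exactly one integer
of the form `Σ a_i p^i` with `a_0 ∈ {1,2}` and `a_i ∈ {0,1}` for `1 ≤ i ≤ k-1`; in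
particular the generated equivalence relation has exactly `2^k` classes. -/
theorem slice_classes (p k : ℕ) (hp : p.Prime) (hodd : Odd p) (hk : 1 ≤ k)
    (R : ℤ → ℤ → Prop)
    (hR : ∀ a b : ℤ, R a b ↔ (b = a + (p : ℤ) ^ k ∨
      (0 ≤ a ∧ ∃ j : ℕ, j ≤ k - 1 ∧
        1 ≤ a % (p : ℤ) ^ (j + 1) ∧
        a % (p : ℤ) ^ (j + 1) ≤ (p : ℤ) ^ (j + 1) - 2 * (p : ℤ) ^ j ∧
        b = a + 2 * (p : ℤ) ^ j))) :
    (∀ z : ℤ, ∃! w : ℤ,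
      (∃ a : ℕ → ℕ, (a 0 = 1 ∨ a 0 = 2) ∧ (∀ i, 1 ≤ i → i ≤ k - 1 → a i ≤ 1) ∧
        w = ∑ i ∈ Finset.range k, (a i : ℤ) * (p : ℤ) ^ i) ∧
      Relation.EqvGen R z w) ∧
    Nat.card (Quot R) = 2 ^ k := by
  have hp2 : (2 : ℤ) ≤ p := by exact_mod_cast hp.two_le
  obtain rfl : R = SliceRel p k := by
    funext a b
    exact propext (hR a b)
  refine ⟨fun z => ⟨sliceRep p k z, ⟨?_, eqvGen_sliceRep hp2 z⟩, ?_⟩, card_quot_sliceRel hp2⟩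
  · refine ⟨fun i => (baseDigit p (z - 1) i % 2).toNat + if i = 0 then 1 else 0, ?_, ?_, ?_⟩
    · simp only [if_true]
      omega
    · intro i hi _
      simp only [if_neg (show i ≠ 0 by omega)]
      omega
    · obtain ⟨n, rfl⟩ := Nat.exists_eq_add_of_le' hk
      have h (i : ℕ) : max (baseDigit p (z - 1) i % 2) 0 = baseDigit p (z - 1) i % 2 :=
        max_eq_left (by omega)
      simp [sliceRep, Finset.sum_range_succ', h]
      ring
  · rintro w ⟨⟨a, ha0, ha, rfl⟩, hw⟩
    have hsum : ∑ i ∈ Finset.range k, (a i : ℤ) * (p : ℤ) ^ i =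
        1 + ∑ i ∈ Finset.range k, ((a i : ℤ) - if i = 0 then 1 else 0) * (p : ℤ) ^ i := by
      obtain ⟨n, rfl⟩ := Nat.exists_eq_add_of_le' hk
      simp [Finset.sum_range_succ']
      ring
    rw [sliceRep_eq_of_eqvGen (by omega) hw, hsum, sliceRep_one_add_sum hp2]
    intro i hi
    split_ifs with h
    · subst h
      omega
    · have := ha i (by omega) (by omega)
      omega
end
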